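/- arXiv:math/0512593 — 2 statements merged into one kernel-verified Lean document; each statement's English description precedes it below -/
import Mathlib

section
/- Let V be a finite-dimensional real vector space and let A ⊆ End_ℝ(V) be a vector subspace of generic rank ℓ. Suppose P : V × V → V is a symmetric bilinear map such that P(X,X) ∈ A(X) for every X ∈ V. Then there exists a linear map Λ : V → A (with values in the subspace A of endomorphisms) such that P(X,Y) = (1/2)(Λ(X)(Y) + Λ(Y)(X)) for all X, Y ∈ V; in particular P(X,X) = Λ(X)(X) for all X. -/
/-- The `A`-hull of a vector `X`: the subspace `{F X : F ∈ A} ⊆ V`. -/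
def Ahull {V : Type*} [AddCommGroup V] [Module ℝ V]
    (A : Submodule ℝ (V →ₗ[ℝ] V)) (X : V) : Submodule ℝ V :=
  A.map (LinearMap.applyₗ X)

/-- `A ⊆ End_ℝ(V)` is of generic rank `ℓ`: `dim A = ℓ` and the set of pairs
`(X,Y)` such that `A(X) + A(Y)` has dimension `2ℓ` is open and dense. -/
def GenericRank {V : Type*} [NormedAddCommGroup V] [NormedSpace ℝ V]
    (A : Submodule ℝ (V →ₗ[ℝ] V)) (ℓ : ℕ) : Prop :=
  Module.finrank ℝ A = ℓ ∧
    IsOpen {p : V × V | Module.finrank ℝ ↥(Ahull A p.1 ⊔ Ahull A p.2) = 2 * ℓ} ∧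
    Dense {p : V × V | Module.finrank ℝ ↥(Ahull A p.1 ⊔ Ahull A p.2) = 2 * ℓ}

/-- If `A(X) + A(Y)` has the largest possible dimension `2 dim A`, then evaluation
`(F, G) ↦ F X + G Y` is injective on `A × A`. -/
theorem eq_zero_of_finrank_Ahull_sup {V : Type*} [AddCommGroup V] [Module ℝ V]
    [FiniteDimensional ℝ V] {A : Submodule ℝ (V →ₗ[ℝ] V)} {X Y : V}
    (h : Module.finrank ℝ ↥(Ahull A X ⊔ Ahull A Y) = 2 * Module.finrank ℝ A)
    {F G : V →ₗ[ℝ] V} (hF : F ∈ A) (hG : G ∈ A) (hFG : F X + G Y = 0) :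
    F = 0 ∧ G = 0 := by
  let φ : A × A →ₗ[ℝ] V :=
    ((LinearMap.applyₗ X).comp A.subtype).coprod ((LinearMap.applyₗ Y).comp A.subtype)
  have hrange : LinearMap.range φ = Ahull A X ⊔ Ahull A Y := by
    simp [φ, LinearMap.range_coprod, LinearMap.range_comp, Ahull]
  have hker : LinearMap.ker φ = ⊥ := by
    have hsum := LinearMap.finrank_range_add_finrank_ker φ
    rw [hrange, h, Module.finrank_prod] at hsum
    exact Submodule.finrank_eq_zero.mp (by omega)
  have hmem : ((⟨F, hF⟩, ⟨G, hG⟩) : A × A) ∈ LinearMap.ker φ := by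
    simpa [φ] using hFG
  rw [hker, Submodule.mem_bot] at hmem
  simpa using hmem

/-- A bilinear map whose associated quadratic map vanishes on a nonempty open set has vanishing
quadratic map. -/
theorem LinearMap.apply_self_eq_zero_of_isOpen {V W : Type*} [NormedAddCommGroup V]
    [NormedSpace ℝ V] [AddCommGroup W] [Module ℝ W] (B : V →ₗ[ℝ] V →ₗ[ℝ] W) {S : Set V}
    (hS : IsOpen S) (hne : S.Nonempty) (hB : ∀ Z ∈ S, B Z Z = 0) (X : V) : B X X = 0 := by
  obtain ⟨Z, hZ⟩ := hne
  have hplus : ∀ᶠ t : ℝ in nhds 0, Z + t • X ∈ S :=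
    ContinuousAt.eventually_mem (by fun_prop) (hS.mem_nhds (by simpa using hZ))
  have hminus : ∀ᶠ t : ℝ in nhds 0, Z - t • X ∈ S :=
    ContinuousAt.eventually_mem (by fun_prop) (hS.mem_nhds (by simpa using hZ))
  obtain ⟨t, ⟨htp, htm⟩, ht⟩ :=
    (((hplus.and hminus).filter_mono nhdsWithin_le_nhds).and
      (self_mem_nhdsWithin : {(0 : ℝ)}ᶜ ∈ nhdsWithin 0 {(0 : ℝ)}ᶜ)).exists
  have ht0 : t ≠ 0 := ht
  have hp := hB _ htp
  have hm := hB _ htm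
  have hz := hB _ hZ
  simp only [map_add, map_sub, map_smul, LinearMap.add_apply, LinearMap.sub_apply,
    LinearMap.smul_apply] at hp hm
  have key : (2 * t * t) • B X X = 0 := by
    linear_combination (norm := module) hp + hm - (2 : ℝ) • hz
  exact (smul_eq_zero.mp key).resolve_left (by positivity)

theorem stmt_0 {V : Type*} [NormedAddCommGroup V] [NormedSpace ℝ V]
    [FiniteDimensional ℝ V]
    (A : Submodule ℝ (V →ₗ[ℝ] V)) (ℓ : ℕ) (hA : GenericRank A ℓ)
    (P : V →ₗ[ℝ] V →ₗ[ℝ] V) (hsymm : ∀ X Y : V, P X Y = P Y X)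
    (hP : ∀ X : V, P X X ∈ Ahull A X) :
    ∃ Λ : V →ₗ[ℝ] (V →ₗ[ℝ] V), (∀ X : V, Λ X ∈ A) ∧
      (∀ X Y : V, P X Y = (1 / 2 : ℝ) • (Λ X Y + Λ Y X)) ∧
      (∀ X : V, P X X = Λ X X) := by
  obtain ⟨hfin, hopen, hdense⟩ := hA
  subst hfin
  choose F hFA hF using hP
  simp only [LinearMap.applyₗ_apply_apply] at hF
  obtain ⟨⟨X₀, Z₀⟩, hgen⟩ := hdense.nonempty
  set S : Set V := {Z | Module.finrank ℝ ↥(Ahull A X₀ ⊔ Ahull A Z) = 2 * Module.finrank ℝ A}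
  have hS : IsOpen S := hopen.preimage (Continuous.prodMk_right X₀)
  have hinj : LinearMap.ker ((LinearMap.applyₗ X₀).comp A.subtype : A →ₗ[ℝ] V) = ⊥ := by
    refine LinearMap.ker_eq_bot'.mpr fun G hG => Subtype.ext ?_
    exact (eq_zero_of_finrank_Ahull_sup hgen G.2 A.zero_mem (by simpa using hG)).1
  obtain ⟨g, hg⟩ := LinearMap.exists_leftInverse_of_injective _ hinj
  let Λ : V →ₗ[ℝ] (V →ₗ[ℝ] V) := A.subtype ∘ₗ g ∘ₗ ((2 : ℝ) • P X₀ - F X₀)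
  have hΛ : ∀ Z ∈ S, Λ Z = F Z := by
    intro Z hZ
    have hp := hF (X₀ + Z)
    have hm := hF (X₀ - Z)
    simp only [map_add, map_sub, LinearMap.add_apply, LinearMap.sub_apply, hsymm Z X₀,
      ← hF X₀, ← hF Z] at hp hm
    have hsum := eq_zero_of_finrank_Ahull_sup hZ
      (F := F (X₀ + Z) + F (X₀ - Z) - (2 : ℝ) • F X₀)
      (G := F (X₀ + Z) - F (X₀ - Z) - (2 : ℝ) • F Z)
      (A.sub_mem (A.add_mem (hFA _) (hFA _)) (A.smul_mem _ (hFA _)))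
      (A.sub_mem (A.sub_mem (hFA _) (hFA _)) (A.smul_mem _ (hFA _)))
      (by
        simp only [LinearMap.add_apply, LinearMap.sub_apply, LinearMap.smul_apply]
        linear_combination (norm := module) hp + hm)
    have hadd : F (X₀ + Z) = F X₀ + F Z := by
      linear_combination (norm := module) (1 / 2 : ℝ) • hsum.1 + (1 / 2 : ℝ) • hsum.2
    have hT : ((2 : ℝ) • P X₀ - F X₀) Z = F Z X₀ := by
      rw [hadd] at hp
      simp only [LinearMap.add_apply, LinearMap.sub_apply, LinearMap.smul_apply] at hp ⊢
      linear_combination (norm := module) -hp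
    have hgF := LinearMap.congr_fun hg ⟨F Z, hFA Z⟩
    simp only [LinearMap.comp_apply, Submodule.subtype_apply, LinearMap.applyₗ_apply_apply,
      LinearMap.id_apply] at hgF
    simp only [Λ, LinearMap.comp_apply, hT, hgF, Submodule.subtype_apply]
  have hdiag : ∀ X, P X X = Λ X X := fun X =>
    sub_eq_zero.mp <| (P - Λ).apply_self_eq_zero_of_isOpen hS ⟨Z₀, hgen⟩
      (fun Z hZ => by simp [hΛ Z hZ, hF]) X
  refine ⟨Λ, fun X => (g _).2, fun X Y => ?_, hdiag⟩
  have hXY := hdiag (X + Y)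
  simp only [map_add, LinearMap.add_apply, hsymm Y X] at hXY
  linear_combination (norm := module) (1 / 2 : ℝ) • (hXY - hdiag X - hdiag Y)
end

section
/- Let V be a finite-dimensional real vector space, let F₀, F₁, …, F_{ℓ-1} ∈ End_ℝ(V) be a basis of a subspace A ⊆ End_ℝ(V) of generic rank ℓ, and let P : V × V → V be a symmetric bilinear map with P(X,X) ∈ A(X) for all X ∈ V. Then there exist linear forms α₀, …, α_{ℓ-1} ∈ V* such that P(X,Y) = (1/2) Σ_{i=0}^{ℓ-1} ( αᵢ(Y) Fᵢ(X) + αᵢ(X) Fᵢ(Y) ) for all X, Y ∈ V. -/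
/-- A bilinear map whose diagonal vanishes on a nonempty open set is alternating. -/
theorem LinearMap.isAlt_of_isOpen {V W : Type*} [NormedAddCommGroup V] [NormedSpace ℝ V]
    [AddCommGroup W] [Module ℝ W] (T : V →ₗ[ℝ] V →ₗ[ℝ] W) {U : Set V} (hU : IsOpen U)
    (hne : U.Nonempty) (hT : ∀ Y ∈ U, T Y Y = 0) (Z : V) : T Z Z = 0 := by
  obtain ⟨Y, hY⟩ := hne
  have hopen : IsOpen ((fun t : ℝ => Y + t • Z) ⁻¹' U) := hU.preimage (by fun_prop)
  obtain ⟨ε, hε, hball⟩ := Metric.isOpen_iff.mp hopen 0 (by simpa using hY)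
  have hmem : ∀ t : ℝ, |t| < ε → T (Y + t • Z) (Y + t • Z) = 0 := fun t ht =>
    hT _ (hball (by simpa [Real.norm_eq_abs] using ht))
  have hhalf : |ε / 2| < ε := by rw [abs_of_pos (by positivity)]; linarith
  have hpos := hmem (ε / 2) hhalf
  have hneg := hmem (-(ε / 2)) (by rwa [abs_neg])
  have hzero := hT Y hY
  simp only [map_add, map_smul, LinearMap.add_apply, LinearMap.smul_apply, hzero] at hpos hneg
  have key : (2 * (ε / 2) ^ 2) • T Z Z = 0 := by
    linear_combination (norm := module) hpos + hneg
  exact (smul_eq_zero.mp key).resolve_left (by positivity)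

theorem Ahull_span_range {V ι : Type*} [AddCommGroup V] [Module ℝ V]
    (F : ι → (V →ₗ[ℝ] V)) (X : V) :
    Ahull (Submodule.span ℝ (Set.range F)) X = Submodule.span ℝ (Set.range fun i => F i X) := by
  rw [Ahull, Submodule.map_span, ← Set.range_comp]
  rfl

theorem mem_Ahull_span_range_iff {V ι : Type*} [AddCommGroup V] [Module ℝ V] [Fintype ι]
    (F : ι → (V →ₗ[ℝ] V)) (X Z : V) :
    Z ∈ Ahull (Submodule.span ℝ (Set.range F)) X ↔ ∃ a : ι → ℝ, Z = ∑ i, a i • F i X := by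
  rw [Ahull_span_range, Submodule.mem_span_range_iff_exists_fun]
  simp [eq_comm]

theorem linearIndependent_sumElim_of_finrank_Ahull {V ι : Type*} [AddCommGroup V] [Module ℝ V]
    [Fintype ι] (F : ι → (V →ₗ[ℝ] V)) {X Y : V}
    (h : Module.finrank ℝ ↥(Ahull (Submodule.span ℝ (Set.range F)) X ⊔
      Ahull (Submodule.span ℝ (Set.range F)) Y) = 2 * Fintype.card ι) :
    LinearIndependent ℝ (Sum.elim (fun i => F i X) (fun i => F i Y)) := by
  rw [linearIndependent_iff_card_eq_finrank_span, Set.finrank, Set.Sum.elim_range,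
    Submodule.span_union, Fintype.card_sum, ← two_mul, ← h,
    Ahull_span_range, Ahull_span_range]

theorem eq_of_sum_smul_add_sum_smul_eq {V ι : Type*} [AddCommGroup V] [Module ℝ V] [Fintype ι]
    {u v : ι → V} (h : LinearIndependent ℝ (Sum.elim u v)) {a b c d : ι → ℝ}
    (heq : ∑ i, a i • u i + ∑ i, b i • v i = ∑ i, c i • u i + ∑ i, d i • v i) :
    a = c ∧ b = d := by
  have hinj := (linearIndependent_iff_injective_fintypeLinearCombination).mp h
  have := @hinj (Sum.elim a b) (Sum.elim c d)
    (by simpa [Fintype.linearCombination_apply, Fintype.sum_sum_type] using heq)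
  exact Sum.elim_eq_iff.mp this

/-- The polarization identity for the coefficients of the diagonal of `P` at a pair of vectors in
general position. -/
theorem two_smul_eq_of_linearIndependent {V ι : Type*} [AddCommGroup V] [Module ℝ V] [Fintype ι]
    (F : ι → (V →ₗ[ℝ] V)) (P : V →ₗ[ℝ] V →ₗ[ℝ] V) (hsymm : ∀ X Y : V, P X Y = P Y X)
    (a : V → ι → ℝ) (ha : ∀ X, P X X = ∑ i, a X i • F i X) {X Y : V}
    (h : LinearIndependent ℝ (Sum.elim (fun i => F i X) (fun i => F i Y))) :
    (2 : ℝ) • P X Y = ∑ i, a Y i • F i X + ∑ i, a X i • F i Y := by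
  have hadd : (2 : ℝ) • P X Y =
      ∑ i, (a (X + Y) - a X) i • F i X + ∑ i, (a (X + Y) - a Y) i • F i Y := by
    have h1 := ha (X + Y)
    simp only [map_add, LinearMap.add_apply, hsymm Y X, smul_add, Finset.sum_add_distrib,
      ha X, ha Y] at h1
    simp only [Pi.sub_apply, sub_smul, Finset.sum_sub_distrib]
    linear_combination (norm := module) h1
  have hsub : (2 : ℝ) • P X Y =
      ∑ i, (a X - a (X - Y)) i • F i X + ∑ i, (a Y + a (X - Y)) i • F i Y := by
    have h1 := ha (X - Y)
    simp only [map_sub, LinearMap.sub_apply, hsymm Y X, smul_sub, Finset.sum_sub_distrib,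
      ha X, ha Y] at h1
    simp only [Pi.sub_apply, Pi.add_apply, sub_smul, add_smul, Finset.sum_sub_distrib,
      Finset.sum_add_distrib]
    linear_combination (norm := module) -h1
  obtain ⟨h1, h2⟩ := eq_of_sum_smul_add_sum_smul_eq h (hadd.symm.trans hsub)
  have hX : a (X + Y) - a X = a Y := by
    funext i
    have h1 := congrFun h1 i
    have h2 := congrFun h2 i
    simp only [Pi.sub_apply, Pi.add_apply] at h1 h2 ⊢
    linarith
  have hY : a (X + Y) - a Y = a X := by rw [← hX]; abel
  rw [hadd, hX, hY]

theorem stmt_1 {V : Type*} [NormedAddCommGroup V] [NormedSpace ℝ V]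
    [FiniteDimensional ℝ V]
    (A : Submodule ℝ (V →ₗ[ℝ] V)) (ℓ : ℕ) (hA : GenericRank A ℓ)
    (F : Fin ℓ → (V →ₗ[ℝ] V)) (hFindep : LinearIndependent ℝ F)
    (hFspan : Submodule.span ℝ (Set.range F) = A)
    (P : V →ₗ[ℝ] V →ₗ[ℝ] V) (hsymm : ∀ X Y : V, P X Y = P Y X)
    (hP : ∀ X : V, P X X ∈ Ahull A X) :
    ∃ α : Fin ℓ → (V →ₗ[ℝ] ℝ), ∀ X Y : V,
      P X Y = (1 / 2 : ℝ) • ∑ i : Fin ℓ, (α i Y • F i X + α i X • F i Y) := by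
  obtain ⟨-, hopen, hdense⟩ := hA
  subst hFspan
  choose a ha using fun X => (mem_Ahull_span_range_iff F X _).mp (hP X)
  obtain ⟨⟨X, Y₀⟩, hXY₀⟩ := hdense.nonempty
  set W : Set V := {Y | Module.finrank ℝ ↥(Ahull (Submodule.span ℝ (Set.range F)) X ⊔
    Ahull (Submodule.span ℝ (Set.range F)) Y) = 2 * ℓ} with hW
  have hWopen : IsOpen W := hopen.preimage (Continuous.prodMk_right X)
  have hWne : W.Nonempty := ⟨Y₀, hXY₀⟩
  have hWind : ∀ Y ∈ W, LinearIndependent ℝ (Sum.elim (fun i => F i X) (fun i => F i Y)) :=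
    fun Y hY => linearIndependent_sumElim_of_finrank_Ahull F (by simpa [hW] using hY)
  have hXind : LinearIndependent ℝ (fun i => F i X) :=
    (hWind Y₀ hXY₀).comp Sum.inl Sum.inl_injective
  let L : V →ₗ[ℝ] V := (2 : ℝ) • P X - ∑ i, a X i • F i
  have hLW : ∀ Y ∈ W, L Y = ∑ i, a Y i • F i X := fun Y hY => by
    have := two_smul_eq_of_linearIndependent F P hsymm a ha (hWind Y hY)
    simp [L, this]
  have hLmem : ∀ Y, L Y ∈ Submodule.span ℝ (Set.range fun i => F i X) := by
    have htop : (Submodule.span ℝ (Set.range fun i => F i X)).comap L = ⊤ := by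
      refine Submodule.eq_top_of_nonempty_interior' _
        (hWne.mono (interior_maximal (fun Y hY => ?_) hWopen))
      exact (Submodule.mem_span_range_iff_exists_fun ℝ).mpr ⟨a Y, (hLW Y hY).symm⟩
    intro Y
    exact (htop ▸ Submodule.mem_top : Y ∈ Submodule.comap L _)
  let β : Fin ℓ → (V →ₗ[ℝ] ℝ) := fun i =>
    Finsupp.lapply i ∘ₗ hXind.repr ∘ₗ L.codRestrict _ hLmem
  have hβ : ∀ Y ∈ W, ∀ i, β i Y = a Y i := fun Y hY i => by
    have : hXind.repr (L.codRestrict _ hLmem Y) = Finsupp.equivFunOnFinite.symm (a Y) := by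
      apply hXind.repr_eq
      simp [hLW Y hY, Finsupp.linearCombination, Finsupp.sum_fintype]
    simp [β, this]
  have halt := LinearMap.isAlt_of_isOpen (P - ∑ i, (β i).smulRight (F i)) hWopen hWne
    (fun Y hY => by simp [ha Y, hβ Y hY])
  refine ⟨β, fun X Y => ?_⟩
  have h1 := LinearMap.IsAlt.neg halt X Y
  simp only [LinearMap.sub_apply, LinearMap.sum_apply, LinearMap.smulRight_apply,
    LinearMap.smul_apply, hsymm Y X] at h1
  rw [Finset.sum_add_distrib]
  linear_combination (norm := module) (-(1 / 2 : ℝ)) • h1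
end
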